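/- (Sign-robust lower bound, scalar form.) Let l < u be real numbers, n ≥ 1 a natural number, δ > 0, and c_0, …, c_n real coefficients. Suppose that either (a) c_{k+1} − c_k ≥ δ for every k ∈ {0,…,n−1}, or (b) c_{k+1} − c_k ≤ −δ for every k ∈ {0,…,n−1}. Then for every x ∈ [l,u], the derivative of the Bernstein activation satisfies |σ'(x)| ≥ n·δ/(u−l). -/

import Mathlib

/-- The Bernstein basis polynomial of degree `n`, index `k`, on the interval `[l, u]`. -/
noncomputable def bernBasis (l u : ℝ) (n k : ℕ) (x : ℝ) : ℝ :=
  (n.choose k : ℝ) / (u - l) ^ n * (x - l) ^ k * (u - x) ^ (n - k)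

/-- The Bernstein activation with coefficients `c 0, …, c n` on `[l, u]`. -/
noncomputable def bernAct (l u : ℝ) (n : ℕ) (c : ℕ → ℝ) (x : ℝ) : ℝ :=
  ∑ k ∈ Finset.range (n + 1), c k * bernBasis l u n k x

theorem hasDerivAt_bernBasis_zero (l u : ℝ) (m : ℕ) (x : ℝ) :
    HasDerivAt (bernBasis l u (m + 1) 0) (-((m + 1) / (u - l) * bernBasis l u m 0 x)) x := by
  have h := (((hasDerivAt_id' x).const_sub u).fun_pow (m + 1)).const_mul (1 / (u - l) ^ (m + 1))
  convert! h using 1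
  · funext y
    simp [bernBasis]
  · simp only [bernBasis, Nat.choose_zero_right, Nat.add_sub_cancel, pow_zero, Nat.sub_zero, div_eq_mul_inv,
      ← inv_pow]
    push_cast
    ring

theorem hasDerivAt_bernBasis_succ (l u : ℝ) (m k : ℕ) (x : ℝ) :
    HasDerivAt (bernBasis l u (m + 1) (k + 1))
      ((m + 1) / (u - l) * (bernBasis l u m k x - bernBasis l u m (k + 1) x)) x := by
  have h := ((((hasDerivAt_id' x).sub_const l).fun_pow (k + 1)).const_mul
    (((m + 1).choose (k + 1) : ℝ) / (u - l) ^ (m + 1))).fun_mul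
    (((hasDerivAt_id' x).const_sub u).fun_pow (m + 1 - (k + 1)))
  convert! h using 1
  have h₁ : ((m : ℝ) + 1) * m.choose k = (m + 1).choose (k + 1) * (k + 1) := by
    exact_mod_cast Nat.add_one_mul_choose_eq m k
  have h₂ : (m.choose (k + 1) : ℝ) * (m + 1) =
      (m + 1).choose (k + 1) * ((m - k : ℕ) : ℝ) := by
    have := Nat.choose_mul_succ_eq m (k + 1)
    rw [Nat.add_sub_add_right] at this
    exact_mod_cast this
  simp only [bernBasis, Nat.add_sub_add_right, Nat.add_sub_cancel, Nat.sub_sub,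
    div_eq_mul_inv, ← inv_pow]
  push_cast
  linear_combination
    ((u - l)⁻¹ ^ (m + 1) * (x - l) ^ k * (u - x) ^ (m - k)) * h₁ -
    ((u - l)⁻¹ ^ (m + 1) * (x - l) ^ (k + 1) * (u - x) ^ (m - (k + 1))) * h₂

/-- The derivative of a Bernstein activation is the Bernstein activation of one degree less on the
successive coefficient differences, rescaled. -/
theorem hasDerivAt_bernAct (l u : ℝ) (m : ℕ) (c : ℕ → ℝ) (x : ℝ) :
    HasDerivAt (bernAct l u (m + 1) c)
      ((m + 1) / (u - l) * bernAct l u m (fun k => c (k + 1) - c k) x) x := by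
  have h := (HasDerivAt.fun_sum (u := Finset.range (m + 1)) fun k _ =>
    (hasDerivAt_bernBasis_succ l u m k x).const_mul (c (k + 1))).fun_add
    ((hasDerivAt_bernBasis_zero l u m x).const_mul (c 0))
  convert! h using 1
  · funext y
    exact Finset.sum_range_succ' _ _
  · have hs : ∑ k ∈ Finset.range (m + 1), c (k + 1) * bernBasis l u m (k + 1) x
        + c 0 * bernBasis l u m 0 x = ∑ k ∈ Finset.range (m + 1), c k * bernBasis l u m k x := by
      rw [← Finset.sum_range_succ' (fun k => c k * bernBasis l u m k x), Finset.sum_range_succ]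
      simp [bernBasis]
    have hd : ∑ k ∈ Finset.range (m + 1), c (k + 1) *
          ((m + 1) / (u - l) * (bernBasis l u m k x - bernBasis l u m (k + 1) x)) =
        (m + 1) / (u - l) * (∑ k ∈ Finset.range (m + 1), c (k + 1) * bernBasis l u m k x -
          ∑ k ∈ Finset.range (m + 1), c (k + 1) * bernBasis l u m (k + 1) x) := by
      rw [← Finset.sum_sub_distrib, Finset.mul_sum]
      exact Finset.sum_congr rfl fun k _ => by ring
    rw [hd]
    simp only [bernAct, sub_mul, Finset.sum_sub_distrib]
    linear_combination ((m + 1) / (u - l)) * hs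

theorem bernBasis_nonneg {l u x : ℝ} (hx : x ∈ Set.Icc l u) (n k : ℕ) :
    0 ≤ bernBasis l u n k x := by
  have hl : 0 ≤ x - l := sub_nonneg.2 hx.1
  have hu : 0 ≤ u - x := sub_nonneg.2 hx.2
  have hlu : 0 ≤ u - l := by linarith
  unfold bernBasis
  positivity

theorem sum_bernBasis {l u : ℝ} (hlu : l ≠ u) (n : ℕ) (x : ℝ) :
    ∑ k ∈ Finset.range (n + 1), bernBasis l u n k x = 1 := by
  have hne : (u - l) ^ n ≠ 0 := pow_ne_zero _ (sub_ne_zero.2 hlu.symm)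
  have h := add_pow (x - l) (u - x) n
  rw [show x - l + (u - x) = u - l by ring] at h
  rw [← div_self hne, eq_div_iff hne, Finset.sum_mul]
  conv_rhs => rw [h]
  exact Finset.sum_congr rfl fun k _ => by unfold bernBasis; field_simp

/-- A Bernstein activation is bounded below on `[l, u]` by any lower bound of its coefficients. -/
theorem le_bernAct {l u x δ : ℝ} (hlu : l < u) (hx : x ∈ Set.Icc l u) {n : ℕ} {d : ℕ → ℝ}
    (hd : ∀ k < n + 1, δ ≤ d k) : δ ≤ bernAct l u n d x := by
  rw [← mul_one δ, ← sum_bernBasis hlu.ne n x, Finset.mul_sum]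
  exact Finset.sum_le_sum fun k hk =>
    mul_le_mul_of_nonneg_right (hd k (Finset.mem_range.1 hk)) (bernBasis_nonneg hx n k)

theorem bernAct_neg (l u : ℝ) (n : ℕ) (d : ℕ → ℝ) (x : ℝ) :
    bernAct l u n (fun k => -d k) x = -bernAct l u n d x := by
  simp [bernAct]

/-- Sign-robust lower bound, scalar form: if either all successive
coefficient differences are `≥ δ`, or all are `≤ −δ`, then for every `x ∈ [l,u]`,
`|σ'(x)| ≥ nδ/(u−l)`. -/
theorem bernstein_sign_robust_lower_bound (l u : ℝ) (hlu : l < u) (n : ℕ) (hn : 1 ≤ n)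
    (δ : ℝ) (hδ : 0 < δ) (c : ℕ → ℝ)
    (hc : (∀ k < n, δ ≤ c (k + 1) - c k) ∨ (∀ k < n, c (k + 1) - c k ≤ -δ)) :
    ∀ x ∈ Set.Icc l u, n * δ / (u - l) ≤ |deriv (bernAct l u n c) x| := by
  intro x hx
  obtain ⟨m, rfl⟩ := Nat.exists_eq_add_of_le' hn
  have hA : 0 ≤ ((m : ℝ) + 1) / (u - l) :=
    div_nonneg (by positivity) (sub_nonneg.2 hlu.le)
  rw [(hasDerivAt_bernAct l u m c x).deriv, abs_mul, abs_of_nonneg hA, mul_div_right_comm]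
  push_cast
  refine mul_le_mul_of_nonneg_left ?_ hA
  rcases hc with hc | hc
  · exact (le_bernAct hlu hx hc).trans (le_abs_self _)
  · have h := le_bernAct hlu hx (d := fun k => -(c (k + 1) - c k)) fun k hk =>
      le_neg_of_le_neg (hc k hk)
    rw [bernAct_neg] at h
    exact h.trans (neg_le_abs _)
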